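/- (Maximality of the number of consecutive integral multiples for n = 1, 2, 3.) For each of the pairs (n, M) = (1, 7), (2, 9), (3, 10), there is no admissible pair (S, H) with d(S) = 12n such that h_m(S,H) = 0 for every m with 1 ≤ m ≤ M. (Hence a nontorsion point on an elliptic curve of discriminant degree 12, 24, or 36 over a complex function field can have at most 6, 8, or 9 consecutive integral multiples P, 2P, …, respectively.) -/

import Mathlib

/-- The periodized second Bernoulli polynomial `B(x) = {x}² − {x} + 1/6`. -/
def bernB (x : ℚ) : ℚ := Int.fract x ^ 2 - Int.fract x + 1 / 6

/-- `d(S) = Σ_{z ∈ S} den(z)`: the sum of the denominators (in lowest terms)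
of the elements of the multiset `S`. -/
def dS (S : Multiset ℚ) : ℕ := (S.map fun z => z.den).sum

/-- `λ_m(S) = Σ_{z ∈ S} den(z)·B(m·z)`. -/
def lamS (m : ℕ) (S : Multiset ℚ) : ℚ :=
  (S.map fun z => (z.den : ℚ) * bernB (m * z)).sum

/-- `h_m(S,H) = m²·H − λ_m(S)`. -/
def hS (m : ℕ) (S : Multiset ℚ) (H : ℚ) : ℚ := (m : ℚ) ^ 2 * H - lamS m S

/-- `(S, H)` is admissible: `S` is a multiset of rationals in `[0, 1/2]`, `H > 0`,
each `h_m(S,H)` is a nonnegative even integer, and `h_{m′}(S,H) ≤ h_m(S,H)`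
whenever `m′ ∣ m`. -/
def Admissible (S : Multiset ℚ) (H : ℚ) : Prop :=
  (∀ z ∈ S, 0 ≤ z ∧ z ≤ 1 / 2) ∧ 0 < H ∧
  (∀ m : ℕ, 0 < m → ∃ k : ℕ, hS m S H = 2 * k) ∧
  (∀ m m' : ℕ, 0 < m' → 0 < m → m' ∣ m → hS m' S H ≤ hS m S H)

/-- The Möbius condition: `Σ_{m′ ∣ m} μ(m/m′)·h_{m′}(S,H) ≥ 0` for all `m ≥ 1`. -/
def MoebiusCond (S : Multiset ℚ) (H : ℚ) : Prop :=
  ∀ m : ℕ, 0 < m →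
    0 ≤ ∑ m' ∈ m.divisors, (ArithmeticFunction.moebius (m / m') : ℚ) * hS m' S H

open Finset in
/-- The sum of the positive parts of `m * a - j * q` over `1 ≤ j ≤ m`. -/
def excess (m a q : ℕ) : ℕ := ∑ j ∈ range m, (m * a - (j + 1) * q)

/-- The pairs `(a, q)` in lowest terms with `a / q ∈ [0, 1/2]` and `q ≤ M`. -/
def halfFarey (M : ℕ) : Finset (ℕ × ℕ) :=
  (Finset.range (M + 1) ×ˢ Finset.range (M + 1)).filter
    fun f => 0 < f.2 ∧ 2 * f.1 ≤ f.2 ∧ Nat.Coprime f.1 f.2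

lemma excess_cast {m a q k s : ℕ} (h : m * a = k * q + s) (hs : s < q) (ha : a ≤ q) :
    (excess m a q : ℚ) = k * s + q * (k * (k - 1) / 2) := by
  have hq : 0 < q := by omega
  have hk : k ≤ m := by
    by_contra! hlt
    nlinarith [Nat.mul_le_mul_left m ha, Nat.mul_le_mul_right q hlt]
  have htail : excess m a q = ∑ j ∈ Finset.range k, (m * a - (j + 1) * q) := by
    refine (Finset.sum_subset (by simpa using hk) fun j _ hj => ?_).symm
    have hkj : k + 1 ≤ j + 1 := by simpa using hj
    have := Nat.mul_le_mul_right q hkj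
    exact Nat.sub_eq_zero_of_le (by linarith)
  have hsum : ∀ x : ℚ, ∀ i : ℕ,
      ∑ j ∈ Finset.range i, (x - (j + 1) * q) = i * x - q * (i * (i + 1) / 2) := by
    intro x i
    induction i with
    | zero => simp
    | succ i ih => rw [Finset.sum_range_succ, ih]; push_cast; ring
  have hcast : (m * a : ℚ) = k * q + s := by exact_mod_cast h
  rw [htail, Nat.cast_sum]
  calc ∑ j ∈ Finset.range k, ((m * a - (j + 1) * q : ℕ) : ℚ)
      = ∑ j ∈ Finset.range k, ((m * a : ℚ) - (j + 1) * q) := by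
        refine Finset.sum_congr rfl fun j hj => ?_
        have hjk : j + 1 ≤ k := by simpa using hj
        have := Nat.mul_le_mul_right q hjk
        rw [Nat.cast_sub (by linarith)]
        push_cast
        ring
    _ = _ := by rw [hsum, hcast]; ring

lemma mul_bernB_div {a q : ℕ} (m : ℕ) (hq : 0 < q) (ha : 2 * a ≤ q) :
    (q : ℚ) * bernB (m * (a / q)) = m ^ 2 * (q * bernB (a / q)) - q * (m ^ 2 - 1) / 6
      + m * (m - 1) * a - 2 * excess m a q := by
  have hq' : (q : ℚ) ≠ 0 := by positivity
  have h := Nat.div_add_mod' (m * a) q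
  have hs := Nat.mod_lt (m * a) hq
  rw [excess_cast h.symm hs (by omega)]
  have hcast : (m * a : ℚ) = (m * a / q : ℕ) * q + (m * a % q : ℕ) := by exact_mod_cast h.symm
  generalize m * a / q = k at *
  generalize m * a % q = s at *
  have hfr : Int.fract ((m : ℚ) * (a / q)) = s / q := by
    rw [Int.fract_eq_iff]
    refine ⟨by positivity, (div_lt_one (by positivity)).2 (by exact_mod_cast hs), k, ?_⟩
    rw [← mul_div_assoc, hcast]
    field_simp
    push_cast
    ring
  have hfr' : Int.fract ((a : ℚ) / q) = a / q := by
    rw [Int.fract_eq_self]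
    refine ⟨by positivity, (div_lt_one (by positivity)).2 ?_⟩
    exact_mod_cast (by omega : a < q)
  rw [bernB, bernB, hfr, hfr']
  have hs' : (s : ℚ) = m * a - k * q := by linarith
  rw [hs']
  field_simp
  ring

/-- A reduced fraction with denominator larger than `M` is the mediant of two others across which
every `excess m` with `m ≤ M` is additive. -/
lemma exists_mediant {M a q : ℕ} (hM : 2 ≤ M) (hMq : M < q) (hc : Nat.Coprime a q)
    (ha : 2 * a ≤ q) :
    ∃ p r p' r' : ℕ, a = p + p' ∧ q = r + r' ∧ 0 < r ∧ 0 < r' ∧ 2 * p ≤ r ∧ 2 * p' ≤ r' ∧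
      Nat.Coprime p r ∧ Nat.Coprime p' r' ∧
      ∀ m ≤ M, excess m a q = excess m p r + excess m p' r' := by
  obtain ⟨r, hr, hr1⟩ := Nat.exists_mul_mod_eq_one_of_coprime hc (by omega)
  have hdet : r * a = a * r / q * q + 1 := by
    have := Nat.div_add_mod' (a * r) q
    rw [hr1] at this
    linarith
  generalize a * r / q = p at hdet
  have hr0 : 0 < r := by
    rcases Nat.eq_zero_or_pos r with rfl | h
    · omega
    · exact h
  have hpa : p ≤ a := by
    by_contra! h
    nlinarith [Nat.mul_le_mul_right q h, Nat.mul_le_mul_right a hr.le]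
  obtain ⟨p', rfl⟩ := Nat.exists_eq_add_of_le hpa
  obtain ⟨r', rfl⟩ := Nat.exists_eq_add_of_le hr.le
  have hdet' : (r : ℤ) * p' = p * r' + 1 := by
    have : (r : ℤ) * (p + p') = p * (r + r') + 1 := by exact_mod_cast hdet
    linarith
  have hsign : ∀ m j : ℕ, m ≤ M →
      (m * p ≤ j * r ∧ m * p' ≤ j * r') ∨ (j * r ≤ m * p ∧ j * r' ≤ m * p') := by
    intro m j hm
    have hkey : (m : ℤ) = (m * p' - j * r') * r - (m * p - j * r) * r' := by
      linear_combination (-(m : ℤ)) * hdet'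
    zify at hm hMq hr0 ⊢
    by_contra! hcon
    obtain ⟨h1, h2⟩ := hcon
    have hr'0 : (0 : ℤ) ≤ r' := by positivity
    rcases lt_or_ge ((m : ℤ) * p) (j * r) with hα | hα
    · have hβ := h1 hα.le
      nlinarith [mul_le_mul_of_nonneg_right (show (1 : ℤ) ≤ m * p' - j * r' by linarith) hr0.le,
        mul_le_mul_of_nonneg_right (show (m : ℤ) * p - j * r ≤ -1 by linarith) hr'0]
    · have hβ := h2 hα
      nlinarith [mul_le_mul_of_nonneg_right (show (m : ℤ) * p' - j * r' ≤ -1 by linarith) hr0.le,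
        mul_nonneg (show (0 : ℤ) ≤ m * p - j * r by linarith) hr'0]
  refine ⟨p, r, p', r', rfl, rfl, hr0, by omega, ?_, ?_, ?_, ?_, fun m hm => ?_⟩
  · have := hsign 2 1 hM; omega
  · have := hsign 2 1 hM; omega
  · rw [← Nat.isCoprime_iff_coprime]
    exact ⟨-r', p', by linarith⟩
  · rw [← Nat.isCoprime_iff_coprime]
    exact ⟨r, -p, by linarith⟩
  · rw [excess, excess, excess, ← Finset.sum_add_distrib]
    refine Finset.sum_congr rfl fun j _ => ?_
    rw [mul_add, mul_add]
    have := hsign m (j + 1) hm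
    omega

lemma exists_halfFarey_weights {M : ℕ} (hM : 2 ≤ M) (q : ℕ) : ∀ a : ℕ, 0 < q → 2 * a ≤ q →
    Nat.Coprime a q → ∃ w : ℕ × ℕ → ℕ,
      a = ∑ f ∈ halfFarey M, w f * f.1 ∧ q = ∑ f ∈ halfFarey M, w f * f.2 ∧
      ∀ m ≤ M, excess m a q = ∑ f ∈ halfFarey M, w f * excess m f.1 f.2 := by
  induction q using Nat.strong_induction_on with
  | _ q ih =>
    intro a hq ha hc
    rcases le_or_gt q M with hqM | hqM
    · have hmem : (a, q) ∈ halfFarey M := by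
        simp only [halfFarey, Finset.mem_filter, Finset.mem_product, Finset.mem_range]
        exact ⟨⟨by omega, by omega⟩, hq, ha, hc⟩
      refine ⟨Pi.single (a, q) 1, ?_, ?_, fun m _ => ?_⟩ <;>
        simp [Pi.single_apply, hmem]
    · obtain ⟨p, r, p', r', rfl, rfl, hr, hr', hp, hp', hpr, hpr', hadd⟩ :=
        exists_mediant hM hqM hc ha
      obtain ⟨w, h1, h2, h3⟩ := ih r (by omega) p hr hp hpr
      obtain ⟨w', h1', h2', h3'⟩ := ih r' (by omega) p' hr' hp' hpr'
      refine ⟨w + w', ?_, ?_, fun m hm => ?_⟩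
      · simp only [Pi.add_apply, add_mul, Finset.sum_add_distrib, ← h1, ← h1']
      · simp only [Pi.add_apply, add_mul, Finset.sum_add_distrib, ← h2, ← h2']
      · simp only [Pi.add_apply, add_mul, Finset.sum_add_distrib, hadd m hm, h3 m hm, h3' m hm]

/-- Every multiset of rationals in `[0, 1/2]` has the same `λ_m - m² λ_1` for `m ≤ M` as some
multiset of fractions with denominators at most `M`. -/
lemma exists_weights_lamS {M : ℕ} (hM : 2 ≤ M) (S : Multiset ℚ)
    (hS : ∀ z ∈ S, 0 ≤ z ∧ z ≤ 1 / 2) :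
    ∃ w : ℕ × ℕ → ℕ, dS S = ∑ f ∈ halfFarey M, w f * f.2 ∧
      ∀ m ≤ M, lamS m S = m ^ 2 * lamS 1 S - dS S * (m ^ 2 - 1) / 6
        + m * (m - 1) * (∑ f ∈ halfFarey M, w f * f.1 : ℕ)
        - 2 * (∑ f ∈ halfFarey M, w f * excess m f.1 f.2 : ℕ) := by
  induction S using Multiset.induction_on with
  | empty => exact ⟨0, by simp [dS, lamS]⟩
  | cons z S ih =>
    obtain ⟨w, hd, hl⟩ := ih fun x hx => hS x (Multiset.mem_cons_of_mem hx)
    obtain ⟨hz0, hz2⟩ := hS z (Multiset.mem_cons_self z S)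
    have hz : z = (z.num.toNat : ℚ) / z.den := by
      have hnum : ((z.num.toNat : ℤ) : ℚ) = z.num := by
        rw [Int.toNat_of_nonneg (Rat.num_nonneg.2 hz0)]
      rw [← Int.cast_natCast, hnum, Rat.num_div_den]
    have hzc : Nat.Coprime z.num.toNat z.den := by
      have := z.reduced
      rwa [← Int.toNat_of_nonneg (Rat.num_nonneg.2 hz0), Int.natAbs_natCast] at this
    have hza : 2 * z.num.toNat ≤ z.den := by
      rw [hz, div_le_iff₀ (by exact_mod_cast z.pos)] at hz2
      have : (2 * z.num.toNat : ℚ) ≤ z.den := by linarith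
      exact_mod_cast this
    obtain ⟨w', ha, hq, he⟩ := exists_halfFarey_weights hM z.den _ z.pos hza hzc
    have hB : ∀ m : ℕ, _ := fun m => mul_bernB_div m z.pos hza
    rw [← hz] at hB
    refine ⟨w' + w, ?_, fun m hm => ?_⟩
    · simp only [Pi.add_apply, add_mul, Finset.sum_add_distrib, ← hq, ← hd]
      simp [dS]
    · have h := hl m hm
      simp only [Pi.add_apply, add_mul, Finset.sum_add_distrib, ← ha, ← he m hm]
      simp only [dS, lamS, Multiset.map_cons, Multiset.sum_cons, hB m] at h ⊢
      rw [h]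
      push_cast
      simp only [one_mul]
      ring

lemma exists_weights_of_hS_eq_zero {n M : ℕ} (hM : 2 ≤ M) {S : Multiset ℚ} {H : ℚ}
    (hS01 : ∀ z ∈ S, 0 ≤ z ∧ z ≤ 1 / 2) (hd : dS S = 12 * n)
    (h0 : ∀ m : ℕ, 1 ≤ m → m ≤ M → hS m S H = 0) :
    ∃ w : ℕ × ℕ → ℕ, 12 * n = ∑ f ∈ halfFarey M, w f * f.2 ∧
      ∀ m, 1 ≤ m → m ≤ M → 2 * ∑ f ∈ halfFarey M, w f * excess m f.1 f.2 + 2 * n * (m ^ 2 - 1)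
        = m * (m - 1) * ∑ f ∈ halfFarey M, w f * f.1 := by
  obtain ⟨w, hw, hl⟩ := exists_weights_lamS hM S hS01
  refine ⟨w, hd ▸ hw, fun m hm hmM => ?_⟩
  have h1 := h0 1 le_rfl (by omega)
  have h2 := h0 m hm hmM
  have h3 := hl m hmM
  rw [hd] at h3
  rw [hS] at h1 h2
  obtain ⟨k, rfl⟩ := Nat.exists_eq_add_of_le' hm
  have hsq : (k + 1) ^ 2 - 1 = k * (k + 2) := by
    rw [Nat.sub_eq_iff_eq_add (Nat.one_le_pow _ _ (by omega))]
    ring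
  rw [hsq, Nat.add_sub_cancel]
  generalize ∑ f ∈ halfFarey M, w f * f.1 = A at *
  generalize ∑ f ∈ halfFarey M, w f * excess (k + 1) f.1 f.2 = E at *
  qify
  push_cast at h1 h2 h3
  linear_combination h3 + h2 - (k + 1) ^ 2 * h1

lemma halfFarey_seven : halfFarey 7 = {(0, 1), (1, 7), (1, 6), (1, 5), (1, 4), (2, 7), (1, 3),
    (2, 5), (3, 7), (1, 2)} := by decide

lemma sum_halfFarey_seven (g : ℕ × ℕ → ℕ) : ∑ f ∈ halfFarey 7, g f =
    g (0, 1) + g (1, 7) + g (1, 6) + g (1, 5) + g (1, 4) + g (2, 7) + g (1, 3) + g (2, 5) + g (3, 7) +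
    g (1, 2) := by
  simp only [halfFarey_seven]
  repeat rw [Finset.sum_insert (by decide)]
  rw [Finset.sum_singleton]
  simp only [add_assoc]

lemma halfFarey_nine : halfFarey 9 = {(0, 1), (1, 9), (1, 8), (1, 7), (1, 6), (1, 5), (2, 9),
    (1, 4), (2, 7), (1, 3), (3, 8), (2, 5), (3, 7), (4, 9), (1, 2)} := by decide

lemma sum_halfFarey_nine (g : ℕ × ℕ → ℕ) : ∑ f ∈ halfFarey 9, g f =
    g (0, 1) + g (1, 9) + g (1, 8) + g (1, 7) + g (1, 6) + g (1, 5) + g (2, 9) + g (1, 4) + g (2, 7) +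
    g (1, 3) + g (3, 8) + g (2, 5) + g (3, 7) + g (4, 9) + g (1, 2) := by
  simp only [halfFarey_nine]
  repeat rw [Finset.sum_insert (by decide)]
  rw [Finset.sum_singleton]
  simp only [add_assoc]

lemma halfFarey_ten : halfFarey 10 = {(0, 1), (1, 10), (1, 9), (1, 8), (1, 7), (1, 6), (1, 5),
    (2, 9), (1, 4), (2, 7), (3, 10), (1, 3), (3, 8), (2, 5), (3, 7), (4, 9), (1, 2)} := by decide

lemma sum_halfFarey_ten (g : ℕ × ℕ → ℕ) : ∑ f ∈ halfFarey 10, g f =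
    g (0, 1) + g (1, 10) + g (1, 9) + g (1, 8) + g (1, 7) + g (1, 6) + g (1, 5) + g (2, 9) + g (1, 4)
    + g (2, 7) + g (3, 10) + g (1, 3) + g (3, 8) + g (2, 5) + g (3, 7) + g (4, 9) + g (1, 2) := by
  simp only [halfFarey_ten]
  repeat rw [Finset.sum_insert (by decide)]
  rw [Finset.sum_singleton]
  simp only [add_assoc]

lemma not_weights_halfFarey_seven (w : ℕ × ℕ → ℕ) (hw : 12 * 1 = ∑ f ∈ halfFarey 7, w f * f.2)
    (h : ∀ m, 1 ≤ m → m ≤ 7 →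
      2 * ∑ f ∈ halfFarey 7, w f * excess m f.1 f.2 + 2 * 1 * (m ^ 2 - 1)
        = m * (m - 1) * ∑ f ∈ halfFarey 7, w f * f.1) : False := by
  have e2 := h 2 (by simp) (by simp)
  have e3 := h 3 (by simp) (by simp)
  have e4 := h 4 (by simp) (by simp)
  have e5 := h 5 (by simp) (by simp)
  have e6 := h 6 (by simp) (by simp)
  have e7 := h 7 (by simp) (by simp)
  simp only [sum_halfFarey_seven, excess, Finset.sum_range_succ, Finset.sum_range_zero, Nat.reduceMul,
    Nat.reduceAdd, Nat.reduceSub, Nat.reducePow, mul_zero, add_zero, zero_add]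
    at hw e2 e3 e4 e5 e6 e7
  clear h
  omega

/-- The nonnegativity conditions left after eliminating nine of the weights on `halfFarey 9`. -/
lemma not_reduced_weights_nine (a c d e f g : ℕ)
    (h0 : a + d + 3 * e + 5 * f + 3 * g ≤ c + 6)
    (h1 : c ≤ a + g)
    (h2 : a + 4 ≤ 2 * d + 6 * e + 9 * f + 2 * g)
    (h3 : 3 * d + 9 * e + 13 * f + 4 * g ≤ 2 * c + 6)
    (h4 : c ≤ d + 2 * e + 2 * f)
    (h5 : c + 6 ≤ a + d + 6 * e + 11 * f + 5 * g)
    (h6 : a + d + 4 * e + 7 * f + 3 * g ≤ c + 4)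
    (h7 : c + 2 ≤ d + 3 * e + 5 * f + 2 * g)
    (h8 : d + 2 * e + 3 * f + g ≤ 2) : False := by
  have hg : g ≤ 2 := by omega
  have hf : f ≤ 0 := by omega
  have he : e ≤ 1 := by omega
  have hd : d ≤ 2 := by omega
  interval_cases g <;> interval_cases f <;> interval_cases e <;> interval_cases d <;> omega

lemma not_weights_halfFarey_nine (w : ℕ × ℕ → ℕ) (hw : 12 * 2 = ∑ f ∈ halfFarey 9, w f * f.2)
    (h : ∀ m, 1 ≤ m → m ≤ 9 →
      2 * ∑ f ∈ halfFarey 9, w f * excess m f.1 f.2 + 2 * 2 * (m ^ 2 - 1)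
        = m * (m - 1) * ∑ f ∈ halfFarey 9, w f * f.1) : False := by
  have e2 := h 2 (by simp) (by simp)
  have e3 := h 3 (by simp) (by simp)
  have e4 := h 4 (by simp) (by simp)
  have e5 := h 5 (by simp) (by simp)
  have e6 := h 6 (by simp) (by simp)
  have e7 := h 7 (by simp) (by simp)
  have e8 := h 8 (by simp) (by simp)
  have e9 := h 9 (by simp) (by simp)
  simp only [sum_halfFarey_nine, excess, Finset.sum_range_succ, Finset.sum_range_zero, Nat.reduceMul,
    Nat.reduceAdd, Nat.reduceSub, Nat.reducePow, mul_zero, add_zero, zero_add]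
    at hw e2 e3 e4 e5 e6 e7 e8 e9
  clear h
  refine not_reduced_weights_nine (w (1, 4)) (w (1, 3)) (w (2, 5)) (w (3, 7)) (w (4, 9)) (w (1, 2))
    ?_ ?_ ?_ ?_ ?_ ?_ ?_ ?_ ?_ <;> omega

/-- The nonnegativity conditions left after eliminating ten of the weights on `halfFarey 10`. -/
lemma not_reduced_weights_ten (a b c d e f g : ℕ)
    (h0 : c ≤ d + 3 * e + 5 * f + 2 * g)
    (h1 : a + 2 * d + 6 * e + 10 * f + 5 * g ≤ b + 2 * c + 9)
    (h2 : 2 * b + 3 * c + 9 ≤ 2 * a + 2 * d + 6 * e + 10 * f + 6 * g)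
    (h3 : a + 6 ≤ 2 * d + 6 * e + 9 * f + 2 * g)
    (h4 : 3 * d + 9 * e + 13 * f + 4 * g ≤ 2 * b + 2 * c + 9)
    (h5 : b + c ≤ d + 2 * e + 2 * f)
    (h6 : b + c + 9 ≤ a + d + 6 * e + 11 * f + 5 * g)
    (h7 : a + d + 4 * e + 7 * f + 3 * g ≤ b + c + 6)
    (h8 : 2 * b + c + 3 ≤ d + 3 * e + 5 * f + 2 * g)
    (h9 : d + 2 * e + 3 * f + g ≤ 3) : False := by
  have hg : g ≤ 3 := by omega
  have hf : f ≤ 1 := by omega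
  have he : e ≤ 1 := by omega
  have hd : d ≤ 3 := by omega
  interval_cases g <;> interval_cases f <;> interval_cases e <;> interval_cases d <;> omega

set_option maxHeartbeats 1000000 in
lemma not_weights_halfFarey_ten (w : ℕ × ℕ → ℕ) (hw : 12 * 3 = ∑ f ∈ halfFarey 10, w f * f.2)
    (h : ∀ m, 1 ≤ m → m ≤ 10 →
      2 * ∑ f ∈ halfFarey 10, w f * excess m f.1 f.2 + 2 * 3 * (m ^ 2 - 1)
        = m * (m - 1) * ∑ f ∈ halfFarey 10, w f * f.1) : False := by
  have e2 := h 2 (by simp) (by simp)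
  have e3 := h 3 (by simp) (by simp)
  have e4 := h 4 (by simp) (by simp)
  have e5 := h 5 (by simp) (by simp)
  have e6 := h 6 (by simp) (by simp)
  have e7 := h 7 (by simp) (by simp)
  have e8 := h 8 (by simp) (by simp)
  have e9 := h 9 (by simp) (by simp)
  have e10 := h 10 (by simp) (by simp)
  simp only [sum_halfFarey_ten, excess, Finset.sum_range_succ, Finset.sum_range_zero, Nat.reduceMul,
    Nat.reduceAdd, Nat.reduceSub, Nat.reducePow, mul_zero, add_zero, zero_add]
    at hw e2 e3 e4 e5 e6 e7 e8 e9 e10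
  clear h
  refine not_reduced_weights_ten (w (1, 4)) (w (3, 10)) (w (1, 3)) (w (2, 5)) (w (3, 7)) (w (4, 9))
    (w (1, 2)) ?_ ?_ ?_ ?_ ?_ ?_ ?_ ?_ ?_ ?_ <;> omega

theorem stmt_19 (n M : ℕ)
    (hnM : (n, M) = (1, 7) ∨ (n, M) = (2, 9) ∨ (n, M) = (3, 10)) :
    ¬ ∃ (S : Multiset ℚ) (H : ℚ), Admissible S H ∧ dS S = 12 * n ∧
      ∀ m : ℕ, 1 ≤ m → m ≤ M → hS m S H = 0 := by
  rintro ⟨S, H, ⟨hS01, -⟩, hd, h0⟩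
  have hM : 2 ≤ M := by
    simp only [Prod.mk.injEq] at hnM
    omega
  obtain ⟨w, hw, hE⟩ := exists_weights_of_hS_eq_zero hM hS01 hd h0
  simp only [Prod.mk.injEq] at hnM
  rcases hnM with ⟨rfl, rfl⟩ | ⟨rfl, rfl⟩ | ⟨rfl, rfl⟩
  · exact not_weights_halfFarey_seven w hw hE
  · exact not_weights_halfFarey_nine w hw hE
  · exact not_weights_halfFarey_ten w hw hE
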